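/- arXiv:math/0308055 — 3 statements merged into one kernel-verified Lean document; each statement's English description precedes it below -/
import Mathlib

section
/- The group with presentation on two generators g₁, g₂ and the two relators g₁^{-4}·g₂·g₁·g₂ and g₁·g₂^{-2}·g₁·g₂ is isomorphic to the group with presentation on two generators a, b and the two relators (a·b)²·a^{-5} and (a·b)²·b^{-3}. -/
/-- Replacing both members of a pair by conjugates does not shrink its normal closure. -/
theorem Subgroup.normalClosure_pair_le_of_isConj {G : Type*} [Group G] {r s r' s' : G}
    (hr : IsConj r r') (hs : IsConj s s') :
    Subgroup.normalClosure {r, s} ≤ Subgroup.normalClosure {r', s'} := by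
  obtain ⟨c, rfl⟩ := isConj_iff.mp hr.symm
  obtain ⟨d, rfl⟩ := isConj_iff.mp hs.symm
  have h := Subgroup.subset_normalClosure (s := {r', s'})
  rw [Set.pair_subset_iff] at h
  exact Subgroup.normalClosure_le_normal (Set.pair_subset
    (Subgroup.normalClosure_normal.conj_mem _ h.1 c)
    (Subgroup.normalClosure_normal.conj_mem _ h.2 d))

/-- Pairs of conjugate elements have the same normal closure. -/
theorem Subgroup.normalClosure_pair_eq_of_isConj {G : Type*} [Group G] {r s r' s' : G}
    (hr : IsConj r r') (hs : IsConj s s') :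
    Subgroup.normalClosure {r, s} = Subgroup.normalClosure {r', s'} :=
  le_antisymm (normalClosure_pair_le_of_isConj hr hs)
    (normalClosure_pair_le_of_isConj hr.symm hs.symm)

/-- The group ⟨g₁,g₂ | g₁⁻⁴g₂g₁g₂, g₁g₂⁻²g₁g₂⟩ is isomorphic to the group
⟨a,b | (ab)²a⁻⁵, (ab)²b⁻³⟩ (the binary icosahedral group). -/
theorem poincare_presentations_iso :
    Nonempty
      (PresentedGroup
          ({FreeGroup.of 0 ^ (-4 : ℤ) * FreeGroup.of 1 * FreeGroup.of 0 * FreeGroup.of 1,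
            FreeGroup.of 0 * FreeGroup.of 1 ^ (-2 : ℤ) * FreeGroup.of 0 * FreeGroup.of 1} :
            Set (FreeGroup (Fin 2))) ≃*
        PresentedGroup
          ({(FreeGroup.of 0 * FreeGroup.of 1) ^ 2 * FreeGroup.of 0 ^ (-5 : ℤ),
            (FreeGroup.of 0 * FreeGroup.of 1) ^ 2 * FreeGroup.of 1 ^ (-3 : ℤ)} :
            Set (FreeGroup (Fin 2)))) := by
  refine ⟨QuotientGroup.quotientMulEquivOfEq
    (Subgroup.normalClosure_pair_eq_of_isConj (isConj_iff.mpr ⟨FreeGroup.of 0 ^ 5, ?_⟩)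
      (isConj_iff.mpr ⟨FreeGroup.of 0 * FreeGroup.of 1, ?_⟩))⟩ <;> rw [pow_two] <;> group
end

section
/- The abelianization of the group with presentation ⟨g₁,g₂ | g₁·g₂^{-1}·g₁^{-1}·g₂²·g₁^{-1}·g₂^{-1}, g₁·g₂·g₁·g₂^{-1}·g₁^{-1}·g₂^{-1}⟩ is the trivial group. (Hence the closed 3-manifold from Hempel's example, whose fundamental group this is, has trivial first homology group and is a homology sphere.) -/
/-- A presented group has trivial abelianization if every homomorphism from the free group on its
generators to that abelianization that kills the relators also kills the generators. -/
theorem PresentedGroup.subsingleton_abelianization {α : Type*} {rels : Set (FreeGroup α)}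
    (h : ∀ φ : FreeGroup α →* Abelianization (PresentedGroup rels),
      (∀ r ∈ rels, φ r = 1) → ∀ a, φ (FreeGroup.of a) = 1) :
    Subsingleton (Abelianization (PresentedGroup rels)) := by
  let φ : FreeGroup α →* Abelianization (PresentedGroup rels) :=
    Abelianization.of.comp (PresentedGroup.mk rels)
  have hφ : φ = 1 := FreeGroup.ext_hom _ _ <| h φ fun r hr => by
    simp [φ, PresentedGroup.one_of_mem hr]
  refine subsingleton_of_forall_eq 1 fun x => ?_
  obtain ⟨y, rfl⟩ := QuotientGroup.mk_surjective x
  obtain ⟨z, rfl⟩ := PresentedGroup.mk_surjective rels y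
  exact DFunLike.congr_fun hφ z

/-- The abelianization of ⟨g₁,g₂ | g₁g₂⁻¹g₁⁻¹g₂²g₁⁻¹g₂⁻¹, g₁g₂g₁g₂⁻¹g₁⁻¹g₂⁻¹⟩
(the fundamental group of Hempel's homology sphere) is the trivial group. -/
theorem hempel_abelianization_trivial :
    Subsingleton
      (Abelianization
        (PresentedGroup
          ({FreeGroup.of 0 * (FreeGroup.of 1)⁻¹ * (FreeGroup.of 0)⁻¹ * FreeGroup.of 1 ^ 2 *
              (FreeGroup.of 0)⁻¹ * (FreeGroup.of 1)⁻¹,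
            FreeGroup.of 0 * FreeGroup.of 1 * FreeGroup.of 0 * (FreeGroup.of 1)⁻¹ *
              (FreeGroup.of 0)⁻¹ * (FreeGroup.of 1)⁻¹} :
            Set (FreeGroup (Fin 2))))) := by
  refine PresentedGroup.subsingleton_abelianization fun φ hφ => ?_
  have h₁ := hφ _ (Set.mem_insert _ _)
  have h₂ := hφ _ (Set.mem_insert_of_mem _ rfl)
  simp only [map_mul, map_inv, map_pow] at h₁ h₂
  generalize h_zero : φ (FreeGroup.of 0) = x at h₁ h₂
  generalize h_one : φ (FreeGroup.of 1) = y at h₁ h₂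
  have hx : x = 1 := by
    rw [← inv_eq_one, ← h₁]
    calc x⁻¹ = (x * x⁻¹) * (y⁻¹ * y) * (y⁻¹ * y) * x⁻¹ := by simp
      _ = _ := by simp only [pow_two]; ac_rfl
  have hy : y = 1 := by
    simpa [hx] using h₂
  exact Fin.forall_fin_two.2 ⟨h_zero.trans hx, h_one.trans hy⟩
end

section
/- The group with presentation on five generators e₁, e₂, e₃, g₁, g₂ and the six relators e₁·e₂·e₃, g₁·g₂, e₁·g₁^{-1}·e₁^{-1}·g₂^{-1}, e₂·g₁, e₂^{-1}·e₃·g₂, and e₃ is isomorphic to the infinite cyclic group ℤ. (This is the fundamental group of the complement of the unknot in S³, computed from its Gauss diagram.) -/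
/-- The group ⟨e₁,e₂,e₃,g₁,g₂ | e₁e₂e₃, g₁g₂, e₁g₁⁻¹e₁⁻¹g₂⁻¹, e₂g₁, e₂⁻¹e₃g₂, e₃⟩ is
isomorphic to ℤ (the fundamental group of the complement of the unknot in S³). -/
theorem unknot_complement_fundamental_group :
    Nonempty
      (PresentedGroup
          ({FreeGroup.of 0 * FreeGroup.of 1 * FreeGroup.of 2,
            FreeGroup.of 3 * FreeGroup.of 4,
            FreeGroup.of 0 * (FreeGroup.of 3)⁻¹ * (FreeGroup.of 0)⁻¹ * (FreeGroup.of 4)⁻¹,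
            FreeGroup.of 1 * FreeGroup.of 3,
            (FreeGroup.of 1)⁻¹ * FreeGroup.of 2 * FreeGroup.of 4,
            FreeGroup.of 2} :
            Set (FreeGroup (Fin 5))) ≃*
        Multiplicative ℤ) := by
  set rels : Set (FreeGroup (Fin 5)) := _
  change Nonempty (PresentedGroup rels ≃* Multiplicative ℤ)
  let t : Multiplicative ℤ := Multiplicative.ofAdd 1
  let v : Fin 5 → Multiplicative ℤ := ![t, t⁻¹, 1, t, t⁻¹]
  have hv : ∀ r ∈ rels, FreeGroup.lift v r = 1 := by
    rintro r (rfl | rfl | rfl | rfl | rfl | rfl) <;> simp [v]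
  let x : Fin 5 → PresentedGroup rels := PresentedGroup.of
  have h₁ : x 0 * x 1 * x 2 = 1 :=
    PresentedGroup.one_of_mem (rels := rels) (by simp [rels])
  have h₂ : x 3 * x 4 = 1 :=
    PresentedGroup.one_of_mem (rels := rels) (by simp [rels])
  have h₄ : x 1 * x 3 = 1 :=
    PresentedGroup.one_of_mem (rels := rels) (by simp [rels])
  have e₂ : x 2 = 1 :=
    PresentedGroup.one_of_mem (rels := rels) (by simp [rels])
  have e₁ : x 1 = (x 0)⁻¹ := by
    rw [e₂, mul_one] at h₁
    exact eq_inv_of_mul_eq_one_right h₁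
  have e₃ : x 3 = x 0 := by
    rw [e₁] at h₄
    exact (inv_mul_eq_one.mp h₄).symm
  have e₄ : x 4 = (x 0)⁻¹ := by
    rw [e₃] at h₂
    exact eq_inv_of_mul_eq_one_right h₂
  let f : PresentedGroup rels →* Multiplicative ℤ := PresentedGroup.toGroup hv
  let g : Multiplicative ℤ →* PresentedGroup rels := zpowersHom _ (x 0)
  have hf : ∀ i, f (x i) = v i := fun _ ↦ PresentedGroup.toGroup.of hv
  have hg : g t = x 0 := by simp [g, t]
  refine ⟨f.toMulEquiv g (PresentedGroup.ext fun i ↦ ?_) (MonoidHom.ext_mint ?_)⟩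
  · change g (f (x i)) = x i
    rw [hf]
    fin_cases i <;> simp [v, hg, e₁, e₂, e₃, e₄]
  · change f (g t) = t
    rw [hg, hf]
    rfl
end
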